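/- arXiv:2306.02896 — 10 statements merged into one kernel-verified Lean document; each statement's English description precedes it below -/
import Mathlib

section
/- There is an absolute constant C > 0 such that for every sequence length N, sparsity q, dimension d′, every accuracy ε > 0, and every embedding dimension m ≥ C·(d′ + q), there exist a function φ: ℝ^d → ℝ^m (with d = d′ + q + 1) and matrices Q, K ∈ ℝ^{m×m}, V ∈ ℝ^{m×d′} such that the self-attention unit with input MLP f(X)_i = Σ_{j=1}^N [exp(⟨Qᵀφ(x_i), Kᵀφ(x_j)⟩) / Σ_{j′=1}^N exp(⟨Qᵀφ(x_i), Kᵀφ(x_{j′})⟩)] · Vᵀφ(x_j) ε-approximates qSA. -/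
open scoped BigOperators

/-- Encoding of a `qSA` input element `x_i = (z_i; y_i; i)` as a vector in `ℝ^d` with
`d = d' + q + 1`: the first `d'` coordinates hold `z_i`, the next `q` coordinates hold the
(sorted) elements of the `q`-element subset `y_i`, and the last coordinate holds the index `i`. -/
noncomputable def encode (N d' q : ℕ) (z : EuclideanSpace ℝ (Fin d'))
    (y : Finset (Fin N)) (i : Fin N) : Fin (d' + q + 1) → ℝ :=
  fun k =>
    if h : (k : ℕ) < d' then z ⟨k, h⟩
    else if (k : ℕ) < d' + q then
      (((((y.sort (· ≤ ·)).map Fin.val).getD ((k : ℕ) - d') 0 : ℕ) : ℝ))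
    else ((i : ℕ) : ℝ)

lemma softmax_bound {E : Type*} [NormedAddCommGroup E] [NormedSpace ℝ E] (N q : ℕ) (hq : 1 ≤ q)
    (w : Fin N → ℝ) (z : Fin N → E) (y : Finset (Fin N)) (η : ℝ) (hη : 0 ≤ η)
    (hc : y.card = q) (hz : ∀ i, ‖z i‖ ≤ 1) (h1 : ∀ j ∈ y, w j = 1)
    (h2 : ∀ j, j ∉ y → 0 ≤ w j ∧ w j ≤ η) :
    ‖(∑ j, (w j / ∑ j', w j') • z j) - (q : ℝ)⁻¹ • ∑ j ∈ y, z j‖ ≤ 2 * N * η := by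
  classical
  have hq' : (1 : ℝ) ≤ q := by exact_mod_cast hq
  have hS : ∑ j, w j = q + ∑ j ∈ yᶜ, w j := by
    rw [← Finset.sum_add_sum_compl y, Finset.sum_congr rfl h1]
    simp [hc]
  have hd0 : 0 ≤ ∑ j ∈ yᶜ, w j :=
    Finset.sum_nonneg fun j hj => (h2 j (by simpa using hj)).1
  have hd1 : ∑ j ∈ yᶜ, w j ≤ N * η := by
    calc ∑ j ∈ yᶜ, w j ≤ ∑ j ∈ yᶜ, η :=
          Finset.sum_le_sum fun j hj => (h2 j (by simpa using hj)).2
      _ ≤ ∑ j : Fin N, η :=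
          Finset.sum_le_sum_of_subset_of_nonneg (Finset.subset_univ _) (fun _ _ _ => hη)
      _ = N * η := by simp
  set S := ∑ j, w j with hSdef
  have hS1 : 1 ≤ S := by linarith
  have hSq : (q : ℝ) ≤ S := by linarith
  have e : (∑ j, (w j / S) • z j) - (q : ℝ)⁻¹ • ∑ j ∈ y, z j
      = ∑ j, (w j / S - if j ∈ y then (q : ℝ)⁻¹ else 0) • z j := by
    simp only [sub_smul, Finset.sum_sub_distrib, ite_smul, zero_smul, Finset.smul_sum]
    simp
  rw [e]
  calc _ ≤ ∑ j, ((if j ∈ y then N * η / q else 0) + η) := by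
        refine norm_sum_le_of_le _ fun j _ => ?_
        rw [norm_smul]
        refine le_trans (mul_le_of_le_one_right (norm_nonneg _) (hz j)) ?_
        by_cases hj : j ∈ y
        · simp only [hj, if_true, h1 j hj]
          have hle : 1 / S ≤ (q : ℝ)⁻¹ := by
            rw [one_div]; exact inv_anti₀ (by linarith) hSq
          rw [Real.norm_eq_abs, abs_sub_comm, abs_of_nonneg (by linarith)]
          have h3 : (q : ℝ)⁻¹ - 1 / S = (S - q) / S / q := by
            have : S ≠ 0 := by linarith
            have : (q : ℝ) ≠ 0 := by linarith
            field_simp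
          have h4 : (S - q) / S ≤ N * η :=
            le_trans (div_le_self (by linarith) hS1) (by linarith)
          rw [h3]
          have : (S - q) / S / q ≤ N * η / q := by gcongr
          linarith
        · simp only [hj, if_false, sub_zero, zero_add]
          obtain ⟨ha, hb⟩ := h2 j hj
          rw [Real.norm_eq_abs, abs_of_nonneg (div_nonneg ha (by linarith))]
          exact le_trans (div_le_self ha hS1) hb
    _ = 2 * N * η := by
        rw [Finset.sum_add_distrib]
        have : (q : ℝ) ≠ 0 := by linarith
        simp [hc]
        field_simp
        ring

/-- Query polynomial read off an encoded input. -/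
noncomputable def qpoly (d' q : ℕ) (T : ℝ) (x : Fin (d' + q + 1) → ℝ) : Polynomial ℝ :=
  Polynomial.C (-T) * ∏ s : Fin q, (Polynomial.X - Polynomial.C (x ⟨d' + s, by omega⟩)) ^ 2

lemma qpoly_eval (d' q : ℕ) (T : ℝ) (x : Fin (d' + q + 1) → ℝ) (t : ℝ) :
    ∑ r : Fin (2 * q + 1), (qpoly d' q T x).coeff r * t ^ (r : ℕ)
      = -T * ∏ s : Fin q, (t - x ⟨d' + s, by omega⟩) ^ 2 := by
  have hdeg : (qpoly d' q T x).natDegree < 2 * q + 1 := by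
    refine Nat.lt_succ_of_le ?_
    refine (Polynomial.natDegree_C_mul_le _ _).trans ?_
    refine (Polynomial.natDegree_prod_le _ _).trans ?_
    refine (Finset.sum_le_sum (g := fun _ => 2) fun s _ => ?_).trans (by simp [mul_comm])
    refine Polynomial.natDegree_pow_le.trans ?_
    simp
  rw [Fin.sum_univ_eq_sum_range (fun r => (qpoly d' q T x).coeff r * t ^ r),
    ← Polynomial.eval_eq_sum_range' hdeg]
  simp [qpoly, Polynomial.eval_prod]

lemma encode_z (N d' q : ℕ) (z : EuclideanSpace ℝ (Fin d')) (y : Finset (Fin N)) (i : Fin N)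
    (c : Fin d') : encode N d' q z y i ⟨c, by omega⟩ = z c := by
  simp [encode]

lemma encode_last (N d' q : ℕ) (z : EuclideanSpace ℝ (Fin d')) (y : Finset (Fin N)) (i : Fin N) :
    encode N d' q z y i ⟨d' + q, by omega⟩ = (i : ℕ) := by
  simp [encode]

lemma encode_y (N d' q : ℕ) (z : EuclideanSpace ℝ (Fin d')) (y : Finset (Fin N)) (i : Fin N)
    (hc : y.card = q) (s : Fin q) :
    encode N d' q z y i ⟨d' + s, by omega⟩ =
      (((y.sort (· ≤ ·))[(s : ℕ)]'(by simp [hc]) : Fin N) : ℕ) := by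
  have : (s : ℕ) < y.card := by omega
  simp [encode, List.getD_eq_getElem?_getD, this]

lemma score_mem (N d' q : ℕ) (T : ℝ) (z : EuclideanSpace ℝ (Fin d')) (y : Finset (Fin N))
    (i : Fin N) (hc : y.card = q) (j : Fin N) (hj : j ∈ y) :
    -T * ∏ s : Fin q, (((j : ℕ) : ℝ) - encode N d' q z y i ⟨d' + s, by omega⟩) ^ 2 = 0 := by
  have hj' : j ∈ y.sort (· ≤ ·) := by simpa using hj
  obtain ⟨n, hn, rfl⟩ := List.getElem_of_mem hj'
  have hn' : n < q := by simpa [hc] using hn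
  rw [Finset.prod_eq_zero (Finset.mem_univ (⟨n, hn'⟩ : Fin q)), mul_zero]
  rw [encode_y N d' q z y i hc ⟨n, hn'⟩]
  simp

lemma score_not_mem (N d' q : ℕ) (T : ℝ) (hT : 0 ≤ T) (z : EuclideanSpace ℝ (Fin d'))
    (y : Finset (Fin N)) (i : Fin N) (hc : y.card = q) (j : Fin N) (hj : j ∉ y) :
    -T * ∏ s : Fin q, (((j : ℕ) : ℝ) - encode N d' q z y i ⟨d' + s, by omega⟩) ^ 2 ≤ -T := by
  have : (1 : ℝ) ≤ ∏ s : Fin q,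
      (((j : ℕ) : ℝ) - encode N d' q z y i ⟨d' + s, by omega⟩) ^ 2 := by
    rw [← Finset.prod_const_one (s := (Finset.univ : Finset (Fin q)))]
    refine Finset.prod_le_prod (fun _ _ => zero_le_one) fun s _ => ?_
    rw [encode_y N d' q z y i hc s]
    set a := (y.sort (· ≤ ·))[(s : ℕ)]'(by simp [hc]) with ha
    have hay : a ∈ y := by
      have : a ∈ y.sort (· ≤ ·) := List.getElem_mem _
      simpa using this
    have hne : ((j : ℕ) : ℤ) - ((a : ℕ) : ℤ) ≠ 0 := by
      intro h
      apply hj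
      have : j = a := Fin.ext (by omega)
      rwa [this]
    have h1 : (1 : ℤ) ≤ (((j : ℕ) : ℤ) - ((a : ℕ) : ℤ)) ^ 2 := by
      have := sq_pos_of_ne_zero hne
      omega
    exact_mod_cast h1
  nlinarith

/-- **Infinite-precision upper bound for `qSA`** (Theorem `qsa-ub-inf-prec`).
There is an absolute constant `C > 0` such that for every sequence length `N`, sparsity `q`,
dimension `d'`, accuracy `ε > 0` and embedding dimension `m ≥ C (d' + q)`, there is a
self-attention unit with input MLP `φ` (i.e. matrices `Q, K ∈ ℝ^{m×m}`, `V ∈ ℝ^{m×d'}`) whose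
output `ε`-approximates `qSA` in `ℓ₂`-norm at every position, over all valid inputs. -/
theorem qSA_selfattention_inf_precision_upper_bound :
    ∃ C : ℝ, 0 < C ∧
      ∀ (N q d' m : ℕ) (ε : ℝ), 0 < ε →
        C * ((d' : ℝ) + (q : ℝ)) ≤ (m : ℝ) →
        ∃ (φ : (Fin (d' + q + 1) → ℝ) → Fin m → ℝ)
          (Q K : Matrix (Fin m) (Fin m) ℝ) (V : Matrix (Fin m) (Fin d') ℝ),
          ∀ (z : Fin N → EuclideanSpace ℝ (Fin d')) (y : Fin N → Finset (Fin N)),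
            (∀ i, ‖z i‖ ≤ 1) → (∀ i, (y i).card = q) →
            ∀ i : Fin N,
              ‖(∑ j : Fin N,
                  (Real.exp (∑ k : Fin m,
                      Q.transpose.mulVec (φ (encode N d' q (z i) (y i) i)) k *
                        K.transpose.mulVec (φ (encode N d' q (z j) (y j) j)) k) /
                    ∑ j' : Fin N,
                      Real.exp (∑ k : Fin m,
                        Q.transpose.mulVec (φ (encode N d' q (z i) (y i) i)) k *
                          K.transpose.mulVec (φ (encode N d' q (z j') (y j') j')) k)) •
                  (EuclideanSpace.equiv (Fin d') ℝ).symm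
                    (V.transpose.mulVec (φ (encode N d' q (z j) (y j) j)))) -
                (q : ℝ)⁻¹ • ∑ j ∈ y i, z j‖ ≤ ε := by
  classical
  refine ⟨6, by norm_num, ?_⟩
  intro N q d' m ε hε hm
  by_cases hq : q = 0
  · subst hq
    refine ⟨0, 0, 0, 0, ?_⟩
    intro z y hz hy i
    simp [hε.le]
  have hq1 : 1 ≤ q := Nat.one_le_iff_ne_zero.mpr hq
  have hm' : 6 * (d' + q) ≤ m := by exact_mod_cast hm
  obtain ⟨e⟩ : Nonempty ((Fin d' ⊕ (Fin (2 * q + 1) ⊕ Fin (2 * q + 1))) ↪ Fin m) := by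
    apply Function.Embedding.nonempty_of_card_le
    simp
    omega
  set η : ℝ := ε / (2 * (N + 1)) with hη
  have hη0 : 0 < η := by positivity
  set T : ℝ := max 0 (-Real.log η) with hT
  have hT0 : 0 ≤ T := le_max_left _ _
  have hTη : Real.exp (-T) ≤ η := by
    rw [← Real.le_log_iff_exp_le hη0]
    have := le_max_right 0 (-Real.log η)
    linarith
  let feat : (Fin (d' + q + 1) → ℝ) → (Fin d' ⊕ (Fin (2 * q + 1) ⊕ Fin (2 * q + 1))) → ℝ :=
    fun x => Sum.elim (fun c => x ⟨c, by omega⟩)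
      (Sum.elim (fun r => (qpoly d' q T x).coeff r) (fun r => x ⟨d' + q, by omega⟩ ^ (r : ℕ)))
  let φ : (Fin (d' + q + 1) → ℝ) → Fin m → ℝ := fun x => Function.extend e (feat x) 0
  have hφ : ∀ x a, φ x (e a) = feat x a := fun x a => e.injective.extend_apply _ _ _
  let K : Matrix (Fin m) (Fin m) ℝ := Matrix.of fun l k =>
    ∑ r, if k = e (Sum.inr (Sum.inl r)) then (if l = e (Sum.inr (Sum.inr r)) then 1 else 0) else 0
  let V : Matrix (Fin m) (Fin d') ℝ := Matrix.of fun l c =>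
    if l = e (Sum.inl c) then 1 else 0
  have hK : ∀ (u v : Fin m → ℝ), ∑ k, (1 : Matrix (Fin m) (Fin m) ℝ).transpose.mulVec u k *
      K.transpose.mulVec v k =
      ∑ r, u (e (Sum.inr (Sum.inl r))) * v (e (Sum.inr (Sum.inr r))) := by
    intro u v
    have hKv : ∀ k, K.transpose.mulVec v k =
        ∑ r, if k = e (Sum.inr (Sum.inl r)) then v (e (Sum.inr (Sum.inr r))) else 0 := by
      intro k
      simp only [Matrix.mulVec, dotProduct, Matrix.transpose_apply, K, Matrix.of_apply,
        Finset.sum_mul]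
      rw [Finset.sum_comm]
      refine Finset.sum_congr rfl fun r _ => ?_
      by_cases h : k = e (Sum.inr (Sum.inl r))
      · simp [h]
      · simp [h]
    simp only [hKv, Matrix.transpose_one, Matrix.one_mulVec, Finset.mul_sum]
    rw [Finset.sum_comm]
    refine Finset.sum_congr rfl fun r _ => ?_
    simp
  have hV : ∀ (v : Fin m → ℝ) c, V.transpose.mulVec v c = v (e (Sum.inl c)) := by
    intro v c
    simp [Matrix.mulVec, dotProduct, V]
  refine ⟨φ, 1, K, V, ?_⟩
  intro z y hz hy i
  have hval : ∀ j, (EuclideanSpace.equiv (Fin d') ℝ).symm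
      (V.transpose.mulVec (φ (encode N d' q (z j) (y j) j))) = z j := by
    intro j
    ext c
    have := hV (φ (encode N d' q (z j) (y j) j)) c
    rw [hφ] at this
    exact this.trans (encode_z N d' q (z j) (y j) j c)
  have hscore : ∀ j, ∑ k, (1 : Matrix (Fin m) (Fin m) ℝ).transpose.mulVec
      (φ (encode N d' q (z i) (y i) i)) k *
      K.transpose.mulVec (φ (encode N d' q (z j) (y j) j)) k =
      -T * ∏ s : Fin q,
        (((j : ℕ) : ℝ) - encode N d' q (z i) (y i) i ⟨d' + s, by omega⟩) ^ 2 := by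
    intro j
    rw [hK, ← qpoly_eval]
    refine Finset.sum_congr rfl fun r _ => ?_
    rw [hφ, hφ]
    simp only [feat, Sum.elim_inr, Sum.elim_inl]
    rw [encode_last]
  simp only [hval, hscore]
  refine (softmax_bound N q hq1 (fun j => Real.exp (-T * ∏ s : Fin q,
        (((j : ℕ) : ℝ) - encode N d' q (z i) (y i) i ⟨d' + s, by omega⟩) ^ 2)) z (y i) η hη0.le
        (hy i) hz ?_ ?_).trans ?_
  · intro j hj
    simp only [score_mem N d' q T (z i) (y i) i (hy i) j hj, Real.exp_zero]
  · intro j hj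
    refine ⟨(Real.exp_pos _).le, le_trans (Real.exp_le_exp.mpr ?_) hTη⟩
    exact score_not_mem N d' q T hT0 (z i) (y i) i (hy i) j hj
  · rw [hη, mul_div_assoc', div_le_iff₀ (by positivity)]
    nlinarith
end

section
/- Let N = 2n + 1 and ε ∈ (0,1). Consider any memory-bounded algorithm with m-bit memory: an initial state h_0 ∈ {0,1}^m together with arbitrary functions g_1, …, g_N with g_i: ℝ^d × {0,1}^m → ℝ × {0,1}^m, which on input X = (x_1, …, x_N) produces outputs and states via (o_i, h_i) = g_i(x_i, h_{i−1}). Suppose that for every 'causal' instance of the 1-sparse-average task with d′ = 1 — i.e., x_i = (z_i, y_i, i) with z_i ∈ [−1, 1], y_i = ∅ for all i ≤ n + 1, and y_i a singleton subset of {1, …, n+1} for all i > n + 1 — the outputs satisfy |o_i − z_{j(i)}| ≤ ε for all i > n + 1, where {j(i)} = y_i. Then m ≥ n = (N − 1)/2. -/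
open scoped BigOperators

/-- The memory state of a memory-bounded (recurrent) algorithm after processing the first
`t` input elements: `h_0` is the initial `m`-bit state and
`(o_i, h_i) = g_i(x_i, h_{i-1})`. Each input element is a pair `(z_i, y_i)` of a real data
scalar and a subset of positions. -/
def rnnState {N m : ℕ}
    (g : Fin N → (ℝ × Finset (Fin N)) → (Fin m → Bool) → ℝ × (Fin m → Bool))
    (h0 : Fin m → Bool) (x : Fin N → ℝ × Finset (Fin N)) : ℕ → (Fin m → Bool)
  | 0 => h0
  | (t + 1) =>
    if h : t < N then (g ⟨t, h⟩ (x ⟨t, h⟩) (rnnState g h0 x t)).2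
    else rnnState g h0 x t

/-- The `i`-th output of the memory-bounded algorithm. -/
def rnnOut {N m : ℕ}
    (g : Fin N → (ℝ × Finset (Fin N)) → (Fin m → Bool) → ℝ × (Fin m → Bool))
    (h0 : Fin m → Bool) (x : Fin N → ℝ × Finset (Fin N)) (i : Fin N) : ℝ :=
  (g i (x i) (rnnState g h0 x (i : ℕ))).1

/-- The state after `t` steps depends only on the first `t` inputs. -/
theorem rnnState_congr {N m : ℕ}
    (g : Fin N → (ℝ × Finset (Fin N)) → (Fin m → Bool) → ℝ × (Fin m → Bool))
    (h0 : Fin m → Bool) (x x' : Fin N → ℝ × Finset (Fin N)) (t : ℕ)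
    (h : ∀ i : Fin N, (i : ℕ) < t → x i = x' i) :
    rnnState g h0 x t = rnnState g h0 x' t := by
  induction t with
  | zero => rfl
  | succ t ih =>
    have ih' := ih (fun i hi => h i (by omega))
    simp only [rnnState]
    split_ifs with ht
    · rw [ih', h ⟨t, ht⟩ (by simp)]
    · exact ih'

/-- **Memory lower bound for recurrent algorithms on causal `1SA`** (Theorem `rnn`).
Let `N = 2n + 1` and `ε ∈ (0,1)`. Any `m`-bit memory-bounded algorithm whose outputs
`ε`-approximate the `1`-sparse average (with `d' = 1`) on all "causal" instances — i.e.
`z_i ∈ [-1,1]`, `y_i = ∅` for positions `i ≤ n + 1`, and `y_i` a singleton subset of the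
first `n+1` positions for `i > n + 1` — must have `m ≥ n = (N-1)/2`.
(Positions are 0-indexed: `(i : ℕ) ≤ n` corresponds to the first `n+1` positions.) -/
theorem qSA_memory_lower_bound (n m : ℕ) (ε : ℝ) (hε0 : 0 < ε) (hε1 : ε < 1)
    (h0 : Fin m → Bool)
    (g : Fin (2 * n + 1) → (ℝ × Finset (Fin (2 * n + 1))) → (Fin m → Bool) →
      ℝ × (Fin m → Bool))
    (hcorrect : ∀ (z : Fin (2 * n + 1) → ℝ) (y : Fin (2 * n + 1) → Finset (Fin (2 * n + 1))),
      (∀ i, |z i| ≤ 1) →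
      (∀ i : Fin (2 * n + 1), (i : ℕ) ≤ n → y i = ∅) →
      (∀ i : Fin (2 * n + 1), n < (i : ℕ) →
        ∃ j : Fin (2 * n + 1), (j : ℕ) ≤ n ∧ y i = {j}) →
      ∀ (i j : Fin (2 * n + 1)), n < (i : ℕ) → y i = {j} →
        |rnnOut g h0 (fun t => (z t, y t)) i - z j| ≤ ε) :
    n ≤ m := by
  rcases Nat.eq_zero_or_pos n with hn | hn
  · omega
  let z : (Fin n → Bool) → Fin (2 * n + 1) → ℝ := fun b i =>
    if h : (i : ℕ) < n then (if b ⟨i, h⟩ then 1 else -1) else 0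
  let y : Fin n → Fin (2 * n + 1) → Finset (Fin (2 * n + 1)) := fun k i =>
    if (i : ℕ) ≤ n then ∅ else {⟨k, by omega⟩}
  let q : Fin (2 * n + 1) := ⟨n + 1, by omega⟩
  have hz : ∀ b i, |z b i| ≤ 1 := by
    intro b i
    simp only [z]
    split_ifs <;> simp
  have key : ∀ b k, |rnnOut g h0 (fun t => (z b t, y k t)) q - (if b k then 1 else -1)| ≤ ε := by
    intro b k
    have := hcorrect (z b) (y k) (hz b) (fun i hi => by simp [y, hi])
      (fun i hi => ⟨⟨k, by omega⟩, by simp, by simp [y, Nat.not_le.mpr hi]⟩)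
      q ⟨k, by omega⟩ (by simp [q]) (by simp [y, q])
    simpa [z] using this
  have hinj : Function.Injective
      (fun b : Fin n → Bool => rnnState g h0 (fun t => (z b t, (∅ : Finset _))) (n + 1)) := by
    intro b b' hbb
    funext k
    have hs : ∀ c, rnnState g h0 (fun t => (z c t, y k t)) (n + 1)
        = rnnState g h0 (fun t => (z c t, (∅ : Finset _))) (n + 1) := by
      intro c
      apply rnnState_congr
      intro i hi
      simp [y, Nat.lt_succ_iff.mp hi]
    have ho : rnnOut g h0 (fun t => (z b t, y k t)) q
        = rnnOut g h0 (fun t => (z b' t, y k t)) q := by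
      have hzq : z b q = z b' q := by simp [z, q]
      have hst : rnnState g h0 (fun t => (z b t, y k t)) (q : ℕ)
          = rnnState g h0 (fun t => (z b' t, y k t)) (q : ℕ) :=
        (hs b).trans (hbb.trans (hs b').symm)
      simp only [rnnOut]
      rw [hst, hzq]
    have h1 := key b k
    have h2 := key b' k
    rw [ho] at h1
    rw [abs_le] at h1 h2
    cases hb : b k <;> cases hb' : b' k <;> simp [hb, hb'] at h1 h2 ⊢ <;> linarith
  have hc := Fintype.card_le_of_injective _ hinj
  simp only [Fintype.card_fun, Fintype.card_bool, Fintype.card_fin] at hc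
  exact (Nat.pow_le_pow_iff_right (by norm_num)).mp hc
end

section
/- Fix N ≥ 2 and M ≥ 2, and set c = M²·log(6N). For X = (x_1, …, x_N) ∈ {1,…,M}^N and i ∈ [N], define s_i = Σ_{j=1}^N exp(c·cos(2π(x_i + x_j)/M)). Then: (a) if there exists j ∈ [N] with x_i + x_j ≡ 0 (mod M), then s_i/(e^c + s_i) ≥ 1/3; (b) if no such j exists, then s_i/(e^c + s_i) ≤ 1/6. Consequently, the map X ↦ (𝟙[s_i/(e^c + s_i) ≥ 1/4])_{i ∈ [N]} computes Match2 exactly; this map is realized by a single self-attention unit of embedding dimension 3 (with one appended blank token, value 1 on genuine tokens and 0 on the blank, and a two-ReLU output MLP) via the embeddings Qᵀφ(x_i) = c(cos(2πx_i/M), sin(2πx_i/M), 1) and Kᵀφ(x_j) = (cos(2πx_j/M), −sin(2πx_j/M), 0). -/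
open scoped BigOperators

/-- `s_i = Σ_{j=1}^N exp(c · cos(2π(x_i + x_j)/M))`, the total (unnormalized) softmax weight
put by position `i` on the genuine tokens in the `Match2` attention construction. -/
noncomputable def s2 (N M : ℕ) (c : ℝ) (x : Fin N → ℕ) (i : Fin N) : ℝ :=
  ∑ j : Fin N, Real.exp (c * Real.cos (2 * Real.pi * (((x i : ℝ) + (x j : ℝ))) / (M : ℝ)))

lemma match2_cos_aux (M r : ℕ) (hM : 2 ≤ M) (h : r % M ≠ 0) :
    Real.cos (2 * Real.pi * (r : ℝ) / M) ≤ 1 - 1 / (M : ℝ) ^ 2 := by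
  have hM0 : (0 : ℝ) < M := by positivity
  have hpi := Real.pi_pos
  -- it suffices to find an integer shift of small absolute value
  have key : ∀ t : ℤ, 1 ≤ |t| → 2 * |t| ≤ M →
      Real.cos (2 * Real.pi * (t : ℝ) / M) ≤ 1 - 1 / (M : ℝ) ^ 2 := by
    intro t h1 h2
    have h1' : (1 : ℝ) ≤ |(t : ℝ)| := by exact_mod_cast h1
    have h2' : 2 * |(t : ℝ)| ≤ M := by exact_mod_cast h2
    have habs : |2 * Real.pi * (t : ℝ) / M| ≤ Real.pi := by
      rw [abs_div, abs_mul, abs_of_pos (by positivity : 0 < 2 * Real.pi), abs_of_pos hM0,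
        div_le_iff₀ hM0]
      nlinarith
    refine (Real.cos_le_one_sub_mul_cos_sq habs).trans ?_
    have e : 2 / Real.pi ^ 2 * (2 * Real.pi * (t : ℝ) / M) ^ 2 = 8 * (t : ℝ) ^ 2 / (M : ℝ) ^ 2 := by
      field_simp
      ring
    rw [e]
    have : 1 / (M : ℝ) ^ 2 ≤ 8 * (t : ℝ) ^ 2 / (M : ℝ) ^ 2 := by
      gcongr
      have := sq_abs (t : ℝ)
      nlinarith
    linarith
  have shift : ∀ q : ℤ, Real.cos (2 * Real.pi * (r : ℝ) / M)
      = Real.cos (2 * Real.pi * (((r : ℤ) - q * M : ℤ) : ℝ) / M) := by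
    intro q
    rw [← Real.cos_sub_int_mul_two_pi _ q]
    congr 1
    push_cast
    field_simp
  have hlt := Nat.mod_lt r (by omega : 0 < M)
  have hdm := Nat.mod_add_div r M
  have hdm' : (r : ℤ) - ((r / M : ℕ) : ℤ) * M = ((r % M : ℕ) : ℤ) := by
    have : ((r % M : ℕ) : ℤ) + M * ((r / M : ℕ) : ℤ) = r := by exact_mod_cast hdm
    linarith
  by_cases hc : 2 * (r % M) ≤ M
  · rw [shift ((r / M : ℕ) : ℤ), hdm']
    apply key
    · rw [abs_of_nonneg (by positivity)]; omega
    · rw [abs_of_nonneg (by positivity)]; omega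
  · have e : (r : ℤ) - (((r / M : ℕ) : ℤ) + 1) * M = ((r % M : ℕ) : ℤ) - M := by
      rw [← hdm']; ring
    rw [shift (((r / M : ℕ) : ℤ) + 1), e]
    apply key
    · rw [abs_of_nonpos (by omega)]; omega
    · rw [abs_of_nonpos (by omega)]; omega

lemma match2_cos_one (M r : ℕ) (hM : 2 ≤ M) (h : r % M = 0) :
    Real.cos (2 * Real.pi * (r : ℝ) / M) = 1 := by
  have hM0 : (0 : ℝ) < M := by positivity
  obtain ⟨k, rfl⟩ := Nat.dvd_of_mod_eq_zero h
  rw [← Real.cos_nat_mul_two_pi k]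
  congr 1
  push_cast
  field_simp

/-- **`Match2` is computed by a single self-attention unit** (Theorem `2attn-pairid`).
With `c = M² log(6N)`: the explicit query/key embeddings
`Qᵀφ(x_i) = c(cos(2πx_i/M), sin(2πx_i/M), 1)` and
`Kᵀφ(x_j) = (cos(2πx_j/M), -sin(2πx_j/M), 0)` produce the scores `c·cos(2π(x_i+x_j)/M)`;
(a) if some `j` has `x_i + x_j ≡ 0 (mod M)` then `s_i/(e^c + s_i) ≥ 1/3`;
(b) otherwise `s_i/(e^c + s_i) ≤ 1/6`; consequently thresholding at `1/4` computes
`Match2` exactly. -/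
theorem match2_single_selfattention (N M : ℕ) (hN : 2 ≤ N) (hM : 2 ≤ M) :
    (∀ u v : ℝ,
      (∑ k : Fin 3,
        (![(M : ℝ) ^ 2 * Real.log (6 * N) * Real.cos (2 * Real.pi * u / M),
           (M : ℝ) ^ 2 * Real.log (6 * N) * Real.sin (2 * Real.pi * u / M),
           (M : ℝ) ^ 2 * Real.log (6 * N)] k) *
        (![Real.cos (2 * Real.pi * v / M), -Real.sin (2 * Real.pi * v / M), 0] k)) =
      (M : ℝ) ^ 2 * Real.log (6 * N) * Real.cos (2 * Real.pi * (u + v) / M)) ∧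
    ∀ x : Fin N → ℕ, (∀ i, 1 ≤ x i ∧ x i ≤ M) →
      ∀ i : Fin N,
        ((∃ j : Fin N, (x i + x j) % M = 0) →
          (1 : ℝ) / 3 ≤ s2 N M ((M : ℝ) ^ 2 * Real.log (6 * N)) x i /
            (Real.exp ((M : ℝ) ^ 2 * Real.log (6 * N)) +
              s2 N M ((M : ℝ) ^ 2 * Real.log (6 * N)) x i)) ∧
        ((¬ ∃ j : Fin N, (x i + x j) % M = 0) →
          s2 N M ((M : ℝ) ^ 2 * Real.log (6 * N)) x i /
            (Real.exp ((M : ℝ) ^ 2 * Real.log (6 * N)) +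
              s2 N M ((M : ℝ) ^ 2 * Real.log (6 * N)) x i) ≤ (1 : ℝ) / 6) ∧
        ((1 : ℝ) / 4 ≤ s2 N M ((M : ℝ) ^ 2 * Real.log (6 * N)) x i /
            (Real.exp ((M : ℝ) ^ 2 * Real.log (6 * N)) +
              s2 N M ((M : ℝ) ^ 2 * Real.log (6 * N)) x i) ↔
          ∃ j : Fin N, (x i + x j) % M = 0) := by
  refine ⟨?_, ?_⟩
  · intro u v
    have e : 2 * Real.pi * (u + v) / M = 2 * Real.pi * u / M + 2 * Real.pi * v / M := by ring
    rw [e, Real.cos_add]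
    simp [Fin.sum_univ_three]
    ring
  intro x _ i
  have hM0 : (0 : ℝ) < M := by positivity
  have hN0 : (0 : ℝ) < N := by positivity
  have hL : 0 ≤ Real.log (6 * N) := by
    apply Real.log_nonneg
    have : (2 : ℝ) ≤ N := by exact_mod_cast hN
    linarith
  set c : ℝ := (M : ℝ) ^ 2 * Real.log (6 * N) with hc
  have hc0 : 0 ≤ c := by positivity
  have hs0 : 0 ≤ s2 N M c x i := Finset.sum_nonneg fun j _ => (Real.exp_pos _).le
  have he := Real.exp_pos c
  have A : (∃ j : Fin N, (x i + x j) % M = 0) →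
      (1 : ℝ) / 3 ≤ s2 N M c x i / (Real.exp c + s2 N M c x i) := by
    rintro ⟨j, hj⟩
    have h1 := match2_cos_one M _ hM hj
    push_cast at h1
    have h2 : Real.exp c ≤ s2 N M c x i := by
      have := Finset.single_le_sum
        (f := fun j => Real.exp (c * Real.cos (2 * Real.pi * (((x i : ℝ) + (x j : ℝ))) / (M : ℝ))))
        (fun j _ => (Real.exp_pos _).le) (Finset.mem_univ j)
      simp only [h1, mul_one] at this
      exact this
    rw [le_div_iff₀ (by linarith)]
    linarith
  have B : (¬ ∃ j : Fin N, (x i + x j) % M = 0) →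
      s2 N M c x i / (Real.exp c + s2 N M c x i) ≤ (1 : ℝ) / 6 := by
    intro h
    have h2 : s2 N M c x i ≤ ∑ _j : Fin N, Real.exp c / (6 * N) := by
      refine Finset.sum_le_sum fun j _ => ?_
      have h1 := match2_cos_aux M (x i + x j) hM fun h' => h ⟨j, h'⟩
      push_cast at h1
      have h3 := mul_le_mul_of_nonneg_left h1 hc0
      have h4 : c * (1 - 1 / (M : ℝ) ^ 2) = c - Real.log (6 * N) := by
        rw [hc]; field_simp
      rw [h4] at h3
      calc _ ≤ Real.exp (c - Real.log (6 * N)) := Real.exp_le_exp.mpr h3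
        _ = _ := by rw [Real.exp_sub, Real.exp_log (by positivity)]
    have h5 : ∑ _j : Fin N, Real.exp c / (6 * N) = Real.exp c / 6 := by
      simp only [Finset.sum_const, Finset.card_univ, Fintype.card_fin, nsmul_eq_mul]
      field_simp
    rw [h5] at h2
    rw [div_le_iff₀ (by linarith)]
    linarith
  refine ⟨A, B, ?_, ?_⟩
  · intro h
    by_contra hn
    have := B hn
    linarith
  · intro h
    have := A h
    linarith
end

section
/- Fix N ≥ 2 and M ≥ 2, and set c = M²·log(6N² + 6). There exist functions q̃, k̃₁, k̃₂: ℝ → ℝ⁵ such that Σ_{k=1}^5 q̃(x)_k·k̃₁(y)_k·k̃₂(z)_k = c·cos(2π(x + y + z)/M) for all x, y, z ∈ ℝ (namely q̃(x) = c(cos θ, −cos θ, sin θ, sin θ, 1), k̃₁(y) = (cos η, sin η, −cos η, sin η, 0), k̃₂(z) = (cos ζ, sin ζ, sin ζ, −cos ζ, 0) with θ = 2πx/M, η = 2πy/M, ζ = 2πz/M). Moreover, defining for X ∈ {1,…,M}^N and i ∈ [N] the quantity s_i = Σ_{j₁=1}^N Σ_{j₂=1}^N exp(c·cos(2π(x_i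 + x_{j₁} + x_{j₂})/M)): if there exist j₁, j₂ with x_i + x_{j₁} + x_{j₂} ≡ 0 (mod M) then s_i/(e^c + s_i) ≥ 1/3, and otherwise s_i/(e^c + s_i) ≤ 1/6. Consequently X ↦ (𝟙[s_i/(e^c + s_i) ≥ 1/4])_i computes Match3 exactly, and is realized by a single third-order self-attention unit with embedding dimension 5 together with an output MLP. -/
open scoped BigOperators

/-- `s_i = Σ_{j₁,j₂} exp(c · cos(2π(x_i + x_{j₁} + x_{j₂})/M))`, the total (unnormalized)
softmax weight put by position `i` on genuine pairs in the third-order `Match3` attention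
construction. -/
noncomputable def s3 (N M : ℕ) (c : ℝ) (x : Fin N → ℕ) (i : Fin N) : ℝ :=
  ∑ j₁ : Fin N, ∑ j₂ : Fin N,
    Real.exp (c * Real.cos (2 * Real.pi * ((x i : ℝ) + (x j₁ : ℝ) + (x j₂ : ℝ)) / (M : ℝ)))

/-- Cosine gap away from multiples of `M`. -/
lemma cos_gap (M n : ℕ) (hM : 2 ≤ M) (h : n % M ≠ 0) :
    1 ≤ (M : ℝ) ^ 2 * (1 - Real.cos (2 * Real.pi * (n : ℝ) / (M : ℝ))) := by
  have hM0 : (0 : ℝ) < M := by exact_mod_cast (by omega : 0 < M)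
  have key : ∀ r k : ℤ, (n : ℤ) = r + k * M → 1 ≤ r ^ 2 → 2 * |r| ≤ M →
      1 ≤ (M : ℝ) ^ 2 * (1 - Real.cos (2 * Real.pi * (n : ℝ) / (M : ℝ))) := by
    intro r k hn hr hrM
    have hn' : (n : ℝ) = r + k * M := by exact_mod_cast hn
    have hr' : (1 : ℝ) ≤ (r : ℝ) ^ 2 := by exact_mod_cast hr
    have hrM' : 2 * |(r : ℝ)| ≤ M := by exact_mod_cast hrM
    have e : 2 * Real.pi * (n : ℝ) / (M : ℝ)
        = 2 * Real.pi * (r : ℝ) / M + k * (2 * Real.pi) := by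
      rw [hn']; field_simp
    rw [e, Real.cos_add_int_mul_two_pi]
    have hpi := Real.pi_pos
    have hb : |2 * Real.pi * (r : ℝ) / M| ≤ Real.pi := by
      rw [abs_div, abs_mul, abs_of_pos hM0, abs_of_pos (by positivity : 0 < 2 * Real.pi),
        div_le_iff₀ hM0]
      nlinarith
    have hc := Real.cos_le_one_sub_mul_cos_sq hb
    have e2 : 2 / Real.pi ^ 2 * (2 * Real.pi * (r : ℝ) / M) ^ 2 = 8 * (r : ℝ) ^ 2 / M ^ 2 := by
      field_simp; ring
    rw [e2] at hc
    have h3 : 8 * (r : ℝ) ^ 2 / M ^ 2 ≤ 1 - Real.cos (2 * Real.pi * (r : ℝ) / M) := by linarith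
    rw [div_le_iff₀ (by positivity)] at h3
    linarith
  have hlt := Nat.mod_lt n (by omega : M > 0)
  have hdm := Nat.mod_add_div n M
  generalize n % M = r at *
  generalize n / M = k at *
  by_cases h2 : 2 * r ≤ M
  · refine key r k ?_ ?_ ?_
    · rw [← hdm]; push_cast; ring
    · have : (1 : ℤ) ≤ r := by omega
      nlinarith
    · rw [abs_of_nonneg (by omega)]; omega
  · refine key ((r : ℤ) - M) (k + 1) ?_ ?_ ?_
    · rw [← hdm]; push_cast; ring
    · have : (1 : ℤ) ≤ M - r := by omega
      nlinarith
    · rw [abs_of_nonpos (by omega)]; omega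

/-- **`Match3` is computed by a single third-order self-attention unit**
(Theorem `3attn-triid`). With `c = M² log(6N² + 6)`: there exist `5`-dimensional embeddings
`q̃, k̃₁, k̃₂` whose trilinear form gives the scores `c·cos(2π(x + y + z)/M)`; moreover
if a matching triple through `i` exists then `s_i/(e^c + s_i) ≥ 1/3`, otherwise
`s_i/(e^c + s_i) ≤ 1/6`; consequently thresholding at `1/4` computes `Match3` exactly. -/
theorem match3_third_order_selfattention (N M : ℕ) (hN : 2 ≤ N) (hM : 2 ≤ M) :
    (∃ qt kt₁ kt₂ : ℝ → Fin 5 → ℝ,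
      ∀ u v t : ℝ,
        (∑ k : Fin 5, qt u k * kt₁ v k * kt₂ t k) =
          (M : ℝ) ^ 2 * Real.log (6 * (N : ℝ) ^ 2 + 6) *
            Real.cos (2 * Real.pi * (u + v + t) / M)) ∧
    ∀ x : Fin N → ℕ, (∀ i, 1 ≤ x i ∧ x i ≤ M) →
      ∀ i : Fin N,
        ((∃ j₁ j₂ : Fin N, (x i + x j₁ + x j₂) % M = 0) →
          (1 : ℝ) / 3 ≤ s3 N M ((M : ℝ) ^ 2 * Real.log (6 * (N : ℝ) ^ 2 + 6)) x i /
            (Real.exp ((M : ℝ) ^ 2 * Real.log (6 * (N : ℝ) ^ 2 + 6)) +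
              s3 N M ((M : ℝ) ^ 2 * Real.log (6 * (N : ℝ) ^ 2 + 6)) x i)) ∧
        ((¬ ∃ j₁ j₂ : Fin N, (x i + x j₁ + x j₂) % M = 0) →
          s3 N M ((M : ℝ) ^ 2 * Real.log (6 * (N : ℝ) ^ 2 + 6)) x i /
            (Real.exp ((M : ℝ) ^ 2 * Real.log (6 * (N : ℝ) ^ 2 + 6)) +
              s3 N M ((M : ℝ) ^ 2 * Real.log (6 * (N : ℝ) ^ 2 + 6)) x i) ≤ (1 : ℝ) / 6) ∧
        ((1 : ℝ) / 4 ≤ s3 N M ((M : ℝ) ^ 2 * Real.log (6 * (N : ℝ) ^ 2 + 6)) x i /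
            (Real.exp ((M : ℝ) ^ 2 * Real.log (6 * (N : ℝ) ^ 2 + 6)) +
              s3 N M ((M : ℝ) ^ 2 * Real.log (6 * (N : ℝ) ^ 2 + 6)) x i) ↔
          ∃ j₁ j₂ : Fin N, (x i + x j₁ + x j₂) % M = 0) := by
  refine ⟨?_, ?_⟩
  · generalize (M : ℝ) ^ 2 * Real.log (6 * (N : ℝ) ^ 2 + 6) = c
    refine ⟨fun u => ![c * Real.cos (2 * Real.pi * u / M), -(c * Real.cos (2 * Real.pi * u / M)),
        c * Real.sin (2 * Real.pi * u / M), c * Real.sin (2 * Real.pi * u / M), c],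
      fun v => ![Real.cos (2 * Real.pi * v / M), Real.sin (2 * Real.pi * v / M),
        -Real.cos (2 * Real.pi * v / M), Real.sin (2 * Real.pi * v / M), 0],
      fun t => ![Real.cos (2 * Real.pi * t / M), Real.sin (2 * Real.pi * t / M),
        Real.sin (2 * Real.pi * t / M), -Real.cos (2 * Real.pi * t / M), 0], ?_⟩
    intro u v t
    have e : 2 * Real.pi * (u + v + t) / M
        = 2 * Real.pi * u / M + 2 * Real.pi * v / M + 2 * Real.pi * t / M := by ring
    rw [e, Real.cos_add, Real.cos_add, Real.sin_add]
    simp [Fin.sum_univ_succ]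
    ring
  · intro x _ i
    have hL : (0 : ℝ) < 6 * (N : ℝ) ^ 2 + 6 := by positivity
    have hL0 : 0 ≤ Real.log (6 * (N : ℝ) ^ 2 + 6) := by
      apply Real.log_nonneg
      nlinarith [sq_nonneg (N : ℝ)]
    have hM0 : (0 : ℝ) < M := by exact_mod_cast (by omega : 0 < M)
    set L := Real.log (6 * (N : ℝ) ^ 2 + 6) with hLdef
    have hexpL : Real.exp L = 6 * (N : ℝ) ^ 2 + 6 := Real.exp_log hL
    set c := (M : ℝ) ^ 2 * L with hc
    have hE := Real.exp_pos c
    have hs0 : 0 ≤ s3 N M c x i := by unfold s3; positivity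
    have A : (∃ j₁ j₂ : Fin N, (x i + x j₁ + x j₂) % M = 0) →
        (1 : ℝ) / 3 ≤ s3 N M c x i / (Real.exp c + s3 N M c x i) := by
      rintro ⟨j₁, j₂, h⟩
      have hge : Real.exp c ≤ s3 N M c x i := by
        obtain ⟨k, hk⟩ := Nat.dvd_of_mod_eq_zero h
        have hk' : (x i : ℝ) + x j₁ + x j₂ = M * k := by exact_mod_cast hk
        have e : Real.exp c = Real.exp (c * Real.cos
            (2 * Real.pi * ((x i : ℝ) + (x j₁ : ℝ) + (x j₂ : ℝ)) / (M : ℝ))) := by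
          have e1 : 2 * Real.pi * ((x i : ℝ) + (x j₁ : ℝ) + (x j₂ : ℝ)) / (M : ℝ)
              = k * (2 * Real.pi) := by
            rw [hk']; field_simp
          rw [e1, Real.cos_nat_mul_two_pi, mul_one]
        rw [e]
        unfold s3
        refine le_trans ?_ (Finset.single_le_sum (f := fun j₁ => ∑ j₂ : Fin N,
          Real.exp (c * Real.cos (2 * Real.pi * ((x i : ℝ) + (x j₁ : ℝ) + (x j₂ : ℝ)) / (M : ℝ))))
          (fun j _ => by positivity) (Finset.mem_univ j₁))
        exact Finset.single_le_sum (f := fun j₂ =>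
          Real.exp (c * Real.cos (2 * Real.pi * ((x i : ℝ) + (x j₁ : ℝ) + (x j₂ : ℝ)) / (M : ℝ))))
          (fun j _ => by positivity) (Finset.mem_univ j₂)
      rw [le_div_iff₀ (by positivity)]
      linarith
    have B : (¬ ∃ j₁ j₂ : Fin N, (x i + x j₁ + x j₂) % M = 0) →
        s3 N M c x i / (Real.exp c + s3 N M c x i) ≤ (1 : ℝ) / 6 := by
      intro h
      have hle : s3 N M c x i ≤ N ^ 2 * (Real.exp c / (6 * (N : ℝ) ^ 2 + 6)) := by
        have hterm : ∀ j₁ j₂ : Fin N, Real.exp (c * Real.cos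
            (2 * Real.pi * ((x i : ℝ) + (x j₁ : ℝ) + (x j₂ : ℝ)) / (M : ℝ)))
            ≤ Real.exp c / (6 * (N : ℝ) ^ 2 + 6) := by
          intro j₁ j₂
          rw [← hexpL, ← Real.exp_sub]
          apply Real.exp_le_exp.mpr
          have g := cos_gap M (x i + x j₁ + x j₂) hM (fun h' => h ⟨j₁, j₂, h'⟩)
          push_cast at g
          have := mul_le_mul_of_nonneg_left g hL0
          rw [hc]
          linarith
        unfold s3
        calc _ ≤ ∑ j₁ : Fin N, ∑ j₂ : Fin N, Real.exp c / (6 * (N : ℝ) ^ 2 + 6) :=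
              Finset.sum_le_sum fun j₁ _ => Finset.sum_le_sum fun j₂ _ => hterm j₁ j₂
          _ = _ := by simp; ring
      rw [← mul_div_assoc, le_div_iff₀ hL] at hle
      rw [div_le_iff₀ (by positivity)]
      nlinarith [sq_nonneg (N : ℝ)]
    refine ⟨A, B, ?_, ?_⟩
    · intro h
      by_contra h'
      have := B h'
      linarith
    · intro h
      have := A h
      linarith
end

section
/- There is a universal constant C > 0 such that the following holds for all N, q, m′ with q < N and m′ < q·(1 − log(Cq)/log N): for every collection of vectors u_1, …, u_N ∈ ℝ^{m′}, there exists a q-element subset S ⊆ [N] that is not linearly separable from its complement; that is, there exist no w ∈ ℝ^{m′} and τ ∈ ℝ with ⟨w, u_i⟩ ≥ τ for all i ∈ S and ⟨w, u_i⟩ < τ for all i ∈ [N] ∖ S. In particular, the convex hull of u_1, …, u_N is not a q-neighborly polytope. -/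
open scoped BigOperators

/-- **Low-dimensional point configurations have a non-separable `q`-subset**
(Fact `not-neighborly`, via Sauer–Shelah). There is a universal constant `C > 0` such that
whenever `q < N` and `m' < q(1 - log(Cq)/log N)`, for every `u_1, …, u_N ∈ ℝ^{m'}` there is
a `q`-element subset `S ⊆ [N]` that no halfspace separates from its complement: there are no
`w ∈ ℝ^{m'}` and `τ ∈ ℝ` with `⟨w, u_i⟩ ≥ τ` exactly for `i ∈ S`. In particular the convex
hull of the `u_i` is not a `q`-neighborly polytope. -/
theorem exists_nonseparable_subset_of_low_dimension :
    ∃ C : ℝ, 0 < C ∧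
      ∀ N q m' : ℕ, q < N →
        (m' : ℝ) < (q : ℝ) * (1 - Real.log (C * q) / Real.log N) →
        ∀ u : Fin N → Fin m' → ℝ,
          ∃ S : Finset (Fin N), S.card = q ∧
            ¬ ∃ (w : Fin m' → ℝ) (τ : ℝ),
                (∀ i ∈ S, τ ≤ ∑ k : Fin m', w k * u i k) ∧
                (∀ i ∉ S, (∑ k : Fin m', w k * u i k) < τ) := by
  refine ⟨2, by norm_num, ?_⟩
  intro N q m hqN h u
  -- numerical consequences of the hypothesis
  have hq : 1 ≤ q := by
    rcases Nat.eq_zero_or_pos q with h0 | h0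
    · subst h0
      have : (0 : ℝ) ≤ m := Nat.cast_nonneg m
      simp at h
      linarith
    · exact h0
  have hN2 : 2 ≤ N := by omega
  have hqR : (1 : ℝ) ≤ q := by exact_mod_cast hq
  have hlogN : 0 < Real.log N := Real.log_pos (by exact_mod_cast hN2)
  have hlogq : 0 ≤ Real.log (2 * q) := Real.log_nonneg (by linarith)
  have hm0 : (0 : ℝ) ≤ m := Nat.cast_nonneg m
  have hdiv : 0 ≤ Real.log (2 * q) / Real.log N := div_nonneg hlogq hlogN.le
  have hmq : m < q := by
    have : (m : ℝ) < q := by nlinarith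
    exact_mod_cast this
  have hNq : 2 * q < N := by
    have h1 : Real.log (2 * q) / Real.log N < 1 := by
      by_contra hc
      push Not at hc
      nlinarith
    rw [div_lt_one hlogN] at h1
    have h2 : (2 * q : ℝ) < N :=
      (Real.log_lt_log_iff (by linarith) (by positivity)).1 h1
    exact_mod_cast h2
  -- Radon partition of the first `m + 2` points
  have hle : m + 2 ≤ N := by omega
  let e : Fin (m + 2) ↪ Fin N := Fin.castLEEmb hle
  have hdep : ¬ AffineIndependent ℝ (fun j => u (e j)) := by
    intro hi
    have := hi.card_le_finrank_succ
    have h3 := Submodule.finrank_le (vectorSpan ℝ (Set.range (fun j => u (e j))))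
    simp at this h3
    omega
  obtain ⟨I, p, hpI, hpJ⟩ := Convex.radon_partition hdep
  classical
  let A : Finset (Fin (m + 2)) := Finset.univ.filter (· ∈ I)
  have hA1 : 1 ≤ A.card := by
    obtain ⟨_, j, hj, _⟩ := convexHull_nonempty_iff.1 ⟨p, hpI⟩
    exact Finset.card_pos.2 ⟨j, by simpa [A] using hj⟩
  have hB1 : 1 ≤ (Aᶜ).card := by
    obtain ⟨_, j, hj, _⟩ := convexHull_nonempty_iff.1 ⟨p, hpJ⟩
    exact Finset.card_pos.2 ⟨j, by simpa [A] using hj⟩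
  have hsum : A.card + (Aᶜ).card = m + 2 := by
    simpa using Finset.card_add_card_compl A
  have hsub : A.map e ⊆ ((Aᶜ).map e)ᶜ := by
    intro x hx
    simp only [Finset.mem_map, Finset.mem_compl] at hx ⊢
    rintro ⟨b, hb, hbx⟩
    obtain ⟨a, ha, rfl⟩ := hx
    exact hb (e.injective hbx ▸ ha)
  obtain ⟨S, hAS, hSB, hS⟩ := Finset.exists_subsuperset_card_eq hsub (n := q)
    (by rw [Finset.card_map]; omega)
    (by rw [Finset.card_compl, Finset.card_map, Fintype.card_fin]; omega)
  refine ⟨S, hS, ?_⟩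
  rintro ⟨w, τ, h1, h2⟩
  have hlin : IsLinearMap ℝ (fun x : Fin m → ℝ => ∑ k, w k * x k) := by
    constructor
    · intro x y
      simp [mul_add, Finset.sum_add_distrib]
    · intro c x
      simp only [Pi.smul_apply, smul_eq_mul, Finset.mul_sum]
      exact Finset.sum_congr rfl fun k _ => by ring
  have hp1 : p ∈ {x : Fin m → ℝ | τ ≤ ∑ k, w k * x k} := by
    refine convexHull_min ?_ (convex_halfSpace_ge hlin τ) hpI
    rintro _ ⟨j, hj, rfl⟩
    exact h1 _ (hAS (Finset.mem_map_of_mem e (by simpa [A] using hj)))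
  have hp2 : p ∈ {x : Fin m → ℝ | ∑ k, w k * x k < τ} := by
    refine convexHull_min ?_ (convex_halfSpace_lt hlin τ) hpJ
    rintro _ ⟨j, hj, rfl⟩
    refine h2 _ fun hmem => ?_
    exact Finset.mem_compl.1 (hSB hmem)
      (Finset.mem_map_of_mem e (by simpa [A] using hj))
  simp only [Set.mem_setOf_eq] at hp1 hp2
  linarith
end

section
/- Let q ≥ 1, d′ ≥ 1, and N ≥ 2q + 1, and let a, b ∈ {0,1}^q. Construct an input X to the q-sparse-average task as follows: y_{2q+1} = {2i − a_i : i ∈ [q]} (a q-element subset of [2q]); for each i ∈ [q], z_{2i−1} = (2b_i − 1)·e_1 and z_{2i} = −e_1 (where e_1 is the first standard basis vector of ℝ^{d′}); and all remaining data vectors z_j (j > 2q) and all subsets y_j (j ≠ 2q+1) are arbitrary valid values. Then qSA(X)_{2q+1} = ((|{i ∈ [q] : a_i b_i = 1}| − |{i ∈ [q] : a_i b_i = 0}|)/q)·e_1. In particular, qSA(X)_{2q+1} = −e_1 if and only if a_i·b_i = 0 for every i ∈ [q] (i.e., the supports of a and b are disjoint), and otherwise ⟨qSA(X)_{2q+1},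 e_1⟩ ≥ −1 + 2/q. -/
open scoped BigOperators

/-- **The set-disjointness encoding into `qSA`** (key step of Theorem `qsa-lb-bound-prec`).
Given `a, b ∈ {0,1}^q`, encode Alice's input by the subset
`y_{2q+1} = {2i - a_i : i ∈ [q]}` (1-indexed; written 0-indexed below as `2i + 1 - a_i`) and
Bob's input by the data vectors `z_{2i-1} = (2b_i - 1)e₁`, `z_{2i} = -e₁`. Then
`qSA(X)_{2q+1} = ((#{i : a_i b_i = 1} - #{i : a_i b_i = 0})/q)·e₁`; in particular
`qSA(X)_{2q+1} = -e₁` iff the supports of `a` and `b` are disjoint, and otherwise its first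
coordinate is at least `-1 + 2/q`. -/
theorem qSA_disjointness_encoding
    (q d' N : ℕ) (hq : 1 ≤ q) (hd : 1 ≤ d') (hN : 2 * q + 1 ≤ N)
    (a b : Fin q → ℕ) (ha : ∀ i, a i ≤ 1) (hb : ∀ i, b i ≤ 1)
    (z : Fin N → EuclideanSpace ℝ (Fin d'))
    (y : Fin N → Finset (Fin N))
    (hy : y ⟨2 * q, by omega⟩ =
      Finset.image
        (fun i : Fin q =>
          (⟨2 * (i : ℕ) + 1 - a i, by have := i.isLt; omega⟩ : Fin N)) Finset.univ)
    (hz1 : ∀ i : Fin q,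
      z ⟨2 * (i : ℕ), by have := i.isLt; omega⟩ =
        (2 * (b i : ℝ) - 1) • EuclideanSpace.single (⟨0, by omega⟩ : Fin d') (1 : ℝ))
    (hz2 : ∀ i : Fin q,
      z ⟨2 * (i : ℕ) + 1, by have := i.isLt; omega⟩ =
        -(EuclideanSpace.single (⟨0, by omega⟩ : Fin d') (1 : ℝ))) :
    ((q : ℝ)⁻¹ • ∑ j ∈ y ⟨2 * q, by omega⟩, z j =
      ((((Finset.univ.filter (fun i : Fin q => a i * b i = 1)).card : ℝ) -
          ((Finset.univ.filter (fun i : Fin q => a i * b i = 0)).card : ℝ)) / (q : ℝ)) •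
        EuclideanSpace.single (⟨0, by omega⟩ : Fin d') (1 : ℝ)) ∧
    ((q : ℝ)⁻¹ • ∑ j ∈ y ⟨2 * q, by omega⟩, z j =
        -(EuclideanSpace.single (⟨0, by omega⟩ : Fin d') (1 : ℝ)) ↔
      ∀ i : Fin q, a i * b i = 0) ∧
    ((¬ ∀ i : Fin q, a i * b i = 0) →
      -1 + 2 / (q : ℝ) ≤
        ((q : ℝ)⁻¹ • ∑ j ∈ y ⟨2 * q, by omega⟩, z j) (⟨0, by omega⟩ : Fin d')) := by
  have hab : ∀ i, a i * b i = 0 ∨ a i * b i = 1 := by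
    intro i
    have h1 := ha i
    have h2 := hb i
    interval_cases a i <;> interval_cases b i <;> simp
  set e := EuclideanSpace.single (⟨0, by omega⟩ : Fin d') (1 : ℝ) with he
  have he0 : e (⟨0, by omega⟩ : Fin d') = 1 := by simp [he]
  have hq0 : (0 : ℝ) < q := by exact_mod_cast hq
  have hcard : ((Finset.univ.filter (fun i : Fin q => a i * b i = 1)).card : ℝ) +
      ((Finset.univ.filter (fun i : Fin q => a i * b i = 0)).card : ℝ) = q := by
    have h := Finset.card_filter_add_card_filter_not (s := (Finset.univ : Finset (Fin q)))
      (fun i : Fin q => a i * b i = 1)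
    have h2 : (Finset.univ.filter (fun i : Fin q => ¬ a i * b i = 1)) =
        Finset.univ.filter (fun i : Fin q => a i * b i = 0) := by
      apply Finset.filter_congr
      intro i _
      have := hab i
      omega
    rw [h2, Finset.card_univ, Fintype.card_fin] at h
    exact_mod_cast h
  have hterm : ∀ i : Fin q,
      z (⟨2 * (i : ℕ) + 1 - a i, by have := i.isLt; omega⟩ : Fin N) =
        ((if a i * b i = 1 then (1 : ℝ) else 0) - (if a i * b i = 0 then (1 : ℝ) else 0)) • e := by
    intro i
    have h1 := ha i
    have h2 := hb i
    have hi := i.isLt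
    rcases (by omega : a i = 0 ∨ a i = 1) with h | h
    · have : (⟨2 * (i : ℕ) + 1 - a i, by omega⟩ : Fin N) = ⟨2 * (i : ℕ) + 1, by omega⟩ := by
        simp [h]
      rw [this, hz2 i]
      simp [h]
    · have : (⟨2 * (i : ℕ) + 1 - a i, by omega⟩ : Fin N) = ⟨2 * (i : ℕ), by omega⟩ := by
        simp [h]
      rw [this, hz1 i]
      rcases (by omega : b i = 0 ∨ b i = 1) with h' | h'
      · simp [h, h']
      · simp only [h, h']
        norm_num
  have hsum : ∑ j ∈ y ⟨2 * q, by omega⟩, z j =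
      (((Finset.univ.filter (fun i : Fin q => a i * b i = 1)).card : ℝ) -
          ((Finset.univ.filter (fun i : Fin q => a i * b i = 0)).card : ℝ)) • e := by
    rw [hy, Finset.sum_image]
    · rw [Finset.sum_congr rfl (fun i _ => hterm i), ← Finset.sum_smul, Finset.sum_sub_distrib,
        Finset.sum_boole, Finset.sum_boole]
    · intro i _ j _ hij
      have h1 := ha i
      have h2 := ha j
      simp only [Fin.mk.injEq] at hij
      apply Fin.ext
      omega
  have hmain : (q : ℝ)⁻¹ • ∑ j ∈ y ⟨2 * q, by omega⟩, z j =
      ((((Finset.univ.filter (fun i : Fin q => a i * b i = 1)).card : ℝ) -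
          ((Finset.univ.filter (fun i : Fin q => a i * b i = 0)).card : ℝ)) / (q : ℝ)) • e := by
    rw [hsum, smul_smul, div_eq_inv_mul]
  rw [hmain]
  have hpos : (¬ ∀ i : Fin q, a i * b i = 0) →
      (1 : ℝ) ≤ ((Finset.univ.filter (fun i : Fin q => a i * b i = 1)).card : ℝ) := by
    intro h
    push Not at h
    obtain ⟨i, hi⟩ := h
    have : 0 < (Finset.univ.filter (fun i : Fin q => a i * b i = 1)).card :=
      Finset.card_pos.mpr ⟨i, by simpa using (hab i).resolve_left hi⟩
    exact_mod_cast this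
  have hbound : (¬ ∀ i : Fin q, a i * b i = 0) → -1 + 2 / (q : ℝ) ≤
      (((Finset.univ.filter (fun i : Fin q => a i * b i = 1)).card : ℝ) -
          ((Finset.univ.filter (fun i : Fin q => a i * b i = 0)).card : ℝ)) / (q : ℝ) := by
    intro h
    have h1 := hpos h
    have h2 : -1 + 2 / (q : ℝ) = (-q + 2) / q := by field_simp
    rw [h2]
    apply div_le_div_of_nonneg_right _ hq0.le
    linarith
  refine ⟨rfl, ⟨?_, ?_⟩, ?_⟩
  · intro h
    by_contra hne
    have h1 := hbound hne
    have h2 := congrArg (fun v : EuclideanSpace ℝ (Fin d') => v (⟨0, by omega⟩ : Fin d')) h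
    simp only [PiLp.smul_apply, PiLp.neg_apply, he0, smul_eq_mul, mul_one] at h2
    have h3 : 0 < 2 / (q : ℝ) := by positivity
    linarith
  · intro h
    have h1 : (Finset.univ.filter (fun i : Fin q => a i * b i = 1)).card = 0 := by
      rw [Finset.card_eq_zero, Finset.filter_eq_empty_iff]
      intro i _
      rw [h i]
      exact zero_ne_one
    rw [h1, Nat.cast_zero, zero_add] at hcard
    rw [h1, hcard, Nat.cast_zero, zero_sub, neg_div, div_self hq0.ne', neg_one_smul]
  · intro h
    simp only [PiLp.smul_apply, he0, smul_eq_mul, mul_one]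
    exact hbound h
end

section
/- Let N ≥ 2 and let X ∈ {0,1}^{N×N} be the adjacency matrix of a directed graph on [N]. For any c > 0 and i ∈ [N], define s_i = Σ_{j₁=1}^N Σ_{j₂=1}^N exp(c · x_{i,j₁} · x_{j₁,j₂} · x_{j₂,i}). Then DirectedCycle3(X)_i = 1 if and only if s_i > N², and in this case s_i ≥ N² − 1 + e^c. Consequently, for every c > 0 and every blank weight w > 0 with N² < N² − 1 + e^c (e.g., c ≥ 1), there is a threshold θ ∈ (0,1) such that DirectedCycle3(X)_i = 𝟙[s_i/(s_i + w) > θ] for all X and i; this realizes DirectedCycle3 by a single third-order graph self-attention unit (score function κ depending on the three edge indicators, uniform values 1, a blank element of weight w and value 0, and a threshold output MLP). -/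
open scoped BigOperators

/-- `s_i = Σ_{j₁,j₂} exp(c · x_{i,j₁} x_{j₁,j₂} x_{j₂,i})`, the total (unnormalized) softmax
weight put by vertex `i` on genuine pairs in the third-order graph-attention construction
for directed-3-cycle detection. -/
noncomputable def sDC3 (N : ℕ) (c : ℝ) (X : Fin N → Fin N → ℕ) (i : Fin N) : ℝ :=
  ∑ j₁ : Fin N, ∑ j₂ : Fin N,
    Real.exp (c * ((X i j₁ * X j₁ j₂ * X j₂ i : ℕ) : ℝ))

theorem sDC3_sub (N : ℕ) (c : ℝ) (X : Fin N → Fin N → ℕ) (i : Fin N) :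
    sDC3 N c X i - (N : ℝ) ^ 2 = ∑ p : Fin N × Fin N,
      (Real.exp (c * ((X i p.1 * X p.1 p.2 * X p.2 i : ℕ) : ℝ)) - 1) := by
  rw [Finset.sum_sub_distrib, Fintype.sum_prod_type]
  simp [sDC3, sq]

theorem sDC3_nonneg_term {c : ℝ} (hc : 0 < c) (n : ℕ) : 0 ≤ Real.exp (c * (n : ℝ)) - 1 := by
  have : 0 ≤ c * (n : ℝ) := by positivity
  linarith [Real.one_le_exp this]

theorem sDC3_ge (N : ℕ) {c : ℝ} (hc : 0 < c) (X : Fin N → Fin N → ℕ) (i : Fin N) :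
    (N : ℝ) ^ 2 ≤ sDC3 N c X i := by
  rw [← sub_nonneg, sDC3_sub]
  exact Finset.sum_nonneg fun p _ => sDC3_nonneg_term hc _

theorem sDC3_ge_of_cycle (N : ℕ) {c : ℝ} (hc : 0 < c) (X : Fin N → Fin N → ℕ) (i : Fin N)
    (h : ∃ j₁ j₂ : Fin N, X i j₁ * X j₁ j₂ * X j₂ i = 1) :
    (N : ℝ) ^ 2 - 1 + Real.exp c ≤ sDC3 N c X i := by
  obtain ⟨a, b, hab⟩ := h
  have h1 := sDC3_sub N c X i
  have h2 := Finset.single_le_sum (s := Finset.univ)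
    (f := fun p : Fin N × Fin N =>
      Real.exp (c * ((X i p.1 * X p.1 p.2 * X p.2 i : ℕ) : ℝ)) - 1)
    (fun p _ => sDC3_nonneg_term hc _) (Finset.mem_univ (a, b))
  simp only [hab, Nat.cast_one, mul_one] at h2
  linarith

theorem sDC3_iff (N : ℕ) {c : ℝ} (hc : 0 < c) (X : Fin N → Fin N → ℕ)
    (hX : ∀ i j, X i j ≤ 1) (i : Fin N) :
    (∃ j₁ j₂ : Fin N, X i j₁ * X j₁ j₂ * X j₂ i = 1) ↔ (N : ℝ) ^ 2 < sDC3 N c X i := by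
  constructor
  · intro h
    have := sDC3_ge_of_cycle N hc X i h
    have := Real.one_lt_exp_iff.2 hc
    linarith
  · intro h
    by_contra hn
    push Not at hn
    have h1 := sDC3_sub N c X i
    rw [Finset.sum_eq_zero] at h1
    · linarith
    · rintro ⟨a, b⟩ -
      have h0 : X i a * X a b * X b i = 0 := by
        have hle : X i a * X a b * X b i ≤ 1 * 1 * 1 :=
          Nat.mul_le_mul (Nat.mul_le_mul (hX _ _) (hX _ _)) (hX _ _)
        have := hn a b
        omega
      simp only [h0]
      simp

/-- **`DirectedCycle3` is computed by a single third-order graph self-attention unit**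
(Theorem `3attn-tricycle`). For any `c > 0`: vertex `i` lies on a directed 3-cycle iff
`s_i > N²`, in which case `s_i ≥ N² - 1 + e^c`. Consequently, for every `c > 0` and blank
weight `w > 0` with `N² < N² - 1 + e^c` (e.g. `c ≥ 1`), there is a threshold `θ ∈ (0,1)`
with `DirectedCycle3(X)_i = 𝟙[s_i/(s_i + w) > θ]` for all `X` and `i`. -/
theorem directedCycle3_third_order_graph_attention (N : ℕ) (hN : 2 ≤ N) :
    (∀ c : ℝ, 0 < c →
      ∀ X : Fin N → Fin N → ℕ, (∀ i j, X i j ≤ 1) →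
        ∀ i : Fin N,
          ((∃ j₁ j₂ : Fin N, X i j₁ * X j₁ j₂ * X j₂ i = 1) ↔
            (N : ℝ) ^ 2 < sDC3 N c X i) ∧
          ((∃ j₁ j₂ : Fin N, X i j₁ * X j₁ j₂ * X j₂ i = 1) →
            (N : ℝ) ^ 2 - 1 + Real.exp c ≤ sDC3 N c X i)) ∧
    (∀ c : ℝ, 0 < c → ∀ w : ℝ, 0 < w →
      (N : ℝ) ^ 2 < (N : ℝ) ^ 2 - 1 + Real.exp c →
      ∃ θ : ℝ, 0 < θ ∧ θ < 1 ∧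
        ∀ X : Fin N → Fin N → ℕ, (∀ i j, X i j ≤ 1) →
          ∀ i : Fin N,
            ((∃ j₁ j₂ : Fin N, X i j₁ * X j₁ j₂ * X j₂ i = 1) ↔
              θ < sDC3 N c X i / (sDC3 N c X i + w))) := by
  refine ⟨fun c hc X hX i => ⟨sDC3_iff N hc X hX i, sDC3_ge_of_cycle N hc X i⟩, ?_⟩
  intro c hc w hw _
  have hN0 : (0 : ℝ) < (N : ℝ) ^ 2 := by
    have : 0 < N := by omega
    positivity
  refine ⟨(N : ℝ) ^ 2 / ((N : ℝ) ^ 2 + w), by positivity, ?_, ?_⟩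
  · rw [div_lt_one (by positivity)]
    linarith
  · intro X hX i
    have hs := sDC3_ge N hc X i
    rw [sDC3_iff N hc X hX i, div_lt_div_iff₀ (by linarith) (by linarith)]
    constructor
    · intro h
      nlinarith
    · intro h
      by_contra hn
      nlinarith
end

section
/- Let N ≥ 2 and let X ∈ {0,1}^{N×N} be a symmetric adjacency matrix. For any c > 0 and i ∈ [N], define s_i = Σ_{j₁,j₂,j₃,j₄ ∈ [N]} exp(c · x_{i,j₁} · x_{j₁,j₂} · x_{j₂,j₃} · x_{j₃,j₄} · x_{j₄,i}). Then Cycle5(X)_i = 1 if and only if s_i > N⁴, and in this case s_i ≥ N⁴ − 1 + e^c. Consequently, for every c ≥ 1 and every blank weight w > 0, there is a threshold θ ∈ (0,1) such that Cycle5(X)_i = 𝟙[s_i/(s_i + w) > θ] for all symmetric X and all i; this realizes Cycle5 by a single fifth-order graph self-attention unit (score function κ depending on the relevant edge indicators, uniform values 1, a blank element of weight w and value 0, and a threshold output MLP). -/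
open scoped BigOperators

/-- `s_i = Σ_{j₁,j₂,j₃,j₄} exp(c · x_{i,j₁} x_{j₁,j₂} x_{j₂,j₃} x_{j₃,j₄} x_{j₄,i})`, the
total (unnormalized) softmax weight put by vertex `i` on genuine 4-tuples in the fifth-order
graph-attention construction for 5-cycle detection. -/
noncomputable def sC5 (N : ℕ) (c : ℝ) (X : Fin N → Fin N → ℕ) (i : Fin N) : ℝ :=
  ∑ j₁ : Fin N, ∑ j₂ : Fin N, ∑ j₃ : Fin N, ∑ j₄ : Fin N,
    Real.exp (c * ((X i j₁ * X j₁ j₂ * X j₂ j₃ * X j₃ j₄ * X j₄ i : ℕ) : ℝ))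

theorem sC5_eq_prod (N : ℕ) (c : ℝ) (X : Fin N → Fin N → ℕ) (i : Fin N) :
    sC5 N c X i = ∑ p : Fin N × Fin N × Fin N × Fin N,
      Real.exp (c * ((X i p.1 * X p.1 p.2.1 * X p.2.1 p.2.2.1 * X p.2.2.1 p.2.2.2
        * X p.2.2.2 i : ℕ) : ℝ)) := by
  simp only [sC5, Fintype.sum_prod_type]

theorem sC5_lower (N : ℕ) (c : ℝ) (hc : 0 < c) (X : Fin N → Fin N → ℕ) (i : Fin N)
    (h : ∃ j₁ j₂ j₃ j₄ : Fin N, X i j₁ * X j₁ j₂ * X j₂ j₃ * X j₃ j₄ * X j₄ i = 1) :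
    (N : ℝ) ^ 4 - 1 + Real.exp c ≤ sC5 N c X i := by
  obtain ⟨a, b, d, e, h⟩ := h
  have h1 : (N : ℝ) ^ 4 - 1 + Real.exp c = ∑ p : Fin N × Fin N × Fin N × Fin N,
      (1 + if p = (a, b, d, e) then Real.exp c - 1 else 0) := by
    rw [Finset.sum_add_distrib, Finset.sum_ite_eq' Finset.univ (a, b, d, e)]
    simp
    ring
  rw [sC5_eq_prod, h1]
  refine Finset.sum_le_sum fun p _ => ?_
  split_ifs with hp
  · subst hp
    simp only [h]
    simp
  · rw [add_zero]
    exact Real.one_le_exp (by positivity)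

theorem sC5_iff (N : ℕ) (c : ℝ) (hc : 0 < c) (X : Fin N → Fin N → ℕ)
    (hX : ∀ i j, X i j ≤ 1) (i : Fin N) :
    (∃ j₁ j₂ j₃ j₄ : Fin N, X i j₁ * X j₁ j₂ * X j₂ j₃ * X j₃ j₄ * X j₄ i = 1) ↔
      (N : ℝ) ^ 4 < sC5 N c X i := by
  constructor
  · intro h
    have h1 := sC5_lower N c hc X i h
    have h2 : 1 < Real.exp c := Real.one_lt_exp_iff.mpr hc
    linarith
  · intro h
    by_contra hne
    push Not at hne
    have h0 : ∀ a b d e : Fin N, X i a * X a b * X b d * X d e * X e i = 0 := by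
      intro a b d e
      have h1 : X i a * X a b * X b d * X d e * X e i ≤ 1 * 1 * 1 * 1 * 1 := by
        gcongr <;> apply hX
      have h2 := hne a b d e
      omega
    have : sC5 N c X i = (N : ℝ) ^ 4 := by
      simp only [sC5, h0]
      simp
      ring
    linarith

/-- **`Cycle5` is computed by a single fifth-order graph self-attention unit**
(Theorem `5attn-fivecycle`). For a symmetric adjacency matrix and any `c > 0`: vertex `i`
lies on a closed walk of length 5 iff `s_i > N⁴`, in which case `s_i ≥ N⁴ - 1 + e^c`.
Consequently, for every `c ≥ 1` and blank weight `w > 0`, there is a threshold `θ ∈ (0,1)`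
with `Cycle5(X)_i = 𝟙[s_i/(s_i + w) > θ]` for all symmetric `X` and all `i`. -/
theorem cycle5_fifth_order_graph_attention (N : ℕ) (hN : 2 ≤ N) :
    (∀ c : ℝ, 0 < c →
      ∀ X : Fin N → Fin N → ℕ, (∀ i j, X i j ≤ 1) → (∀ i j, X i j = X j i) →
        ∀ i : Fin N,
          ((∃ j₁ j₂ j₃ j₄ : Fin N, X i j₁ * X j₁ j₂ * X j₂ j₃ * X j₃ j₄ * X j₄ i = 1) ↔
            (N : ℝ) ^ 4 < sC5 N c X i) ∧
          ((∃ j₁ j₂ j₃ j₄ : Fin N, X i j₁ * X j₁ j₂ * X j₂ j₃ * X j₃ j₄ * X j₄ i = 1) →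
            (N : ℝ) ^ 4 - 1 + Real.exp c ≤ sC5 N c X i)) ∧
    (∀ c : ℝ, 1 ≤ c → ∀ w : ℝ, 0 < w →
      ∃ θ : ℝ, 0 < θ ∧ θ < 1 ∧
        ∀ X : Fin N → Fin N → ℕ, (∀ i j, X i j ≤ 1) → (∀ i j, X i j = X j i) →
          ∀ i : Fin N,
            ((∃ j₁ j₂ j₃ j₄ : Fin N, X i j₁ * X j₁ j₂ * X j₂ j₃ * X j₃ j₄ * X j₄ i = 1) ↔
              θ < sC5 N c X i / (sC5 N c X i + w))) := by
  refine ⟨fun c hc X hX _ i => ⟨sC5_iff N c hc X hX i, sC5_lower N c hc X i⟩, ?_⟩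
  intro c hc w hw
  have hN0 : (0 : ℝ) < N := by
    have : 0 < N := by omega
    exact_mod_cast this
  have hM : (0 : ℝ) < (N : ℝ) ^ 4 := by positivity
  refine ⟨(N : ℝ) ^ 4 / ((N : ℝ) ^ 4 + w), by positivity, ?_, ?_⟩
  · rw [div_lt_one (by positivity)]
    linarith
  · intro X hX _ i
    have hs : 0 ≤ sC5 N c X i := by
      unfold sC5
      positivity
    rw [sC5_iff N c (by linarith) X hX i, div_lt_div_iff₀ (by positivity) (by positivity)]
    constructor
    · intro h
      nlinarith
    · intro h
      by_contra hle
      nlinarith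
end

section
/- Let N be divisible by 5, set n = N²/25, and let a, b ∈ {0,1}^{[N/5]×[N/5]}. Define the symmetric matrix X ∈ {0,1}^{N×N} by: x_{i,j} = x_{j,i} = a_{i, j−N/5} for i ∈ (0, N/5] and j ∈ (N/5, 2N/5]; x_{i,j} = x_{j,i} = 𝟙[i = j − N/5] for i ∈ (N/5, 3N/5] and j ∈ (2N/5, 4N/5]; x_{i,j} = x_{j,i} = b_{j−4N/5, i−3N/5} for i ∈ (3N/5, 4N/5] and j ∈ (4N/5, N]; x_{i,j} = x_{j,i} = 𝟙[i = j + 4N/5] for i ∈ (4N/5, N] and j ∈ (0, N/5]; and x_{i,j} = 0 for all other pairs. Then the undirected graph with adjacency matrix X contains a cycle of length 5 if and only if there exist i, j ∈ [N/5] with a_{i,j} = b_{i,j} = 1 (in which case (i, N/5+j, 2N/5+j, 3N/5+j, 4N/5+i) is such a cycle). -/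
open scoped BigOperators

/-- The symmetric adjacency matrix (1-indexed, on vertices `1, …, 5n`) encoding a
set-disjointness instance `a, b ∈ {0,1}^{[n]×[n]}` for the 5-cycle lower bound:
`a`-edges between blocks 1 and 2, perfect matchings between blocks 2–3, 3–4 and 5–1,
`b`-edges between blocks 4 and 5, and no other edges. -/
def cycle5X (n : ℕ) (a b : ℕ → ℕ → ℕ) : ℕ → ℕ → ℕ := fun i j =>
  if 1 ≤ i ∧ i ≤ n ∧ n + 1 ≤ j ∧ j ≤ 2 * n then a i (j - n)
  else if 1 ≤ j ∧ j ≤ n ∧ n + 1 ≤ i ∧ i ≤ 2 * n then a j (i - n)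
  else if n + 1 ≤ i ∧ i ≤ 3 * n ∧ 2 * n + 1 ≤ j ∧ j ≤ 4 * n then (if j = i + n then 1 else 0)
  else if n + 1 ≤ j ∧ j ≤ 3 * n ∧ 2 * n + 1 ≤ i ∧ i ≤ 4 * n then (if i = j + n then 1 else 0)
  else if 3 * n + 1 ≤ i ∧ i ≤ 4 * n ∧ 4 * n + 1 ≤ j ∧ j ≤ 5 * n then b (j - 4 * n) (i - 3 * n)
  else if 3 * n + 1 ≤ j ∧ j ≤ 4 * n ∧ 4 * n + 1 ≤ i ∧ i ≤ 5 * n then b (i - 4 * n) (j - 3 * n)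
  else if 4 * n + 1 ≤ i ∧ i ≤ 5 * n ∧ 1 ≤ j ∧ j ≤ n then (if i = j + 4 * n then 1 else 0)
  else if 4 * n + 1 ≤ j ∧ j ≤ 5 * n ∧ 1 ≤ i ∧ i ≤ n then (if j = i + 4 * n then 1 else 0)
  else 0

/-- Edge `u → v` oriented along the ring of blocks. -/
def Up5 (n : ℕ) (a b : ℕ → ℕ → ℕ) (u v : ℕ) : Prop :=
  (1 ≤ u ∧ u ≤ n ∧ n + 1 ≤ v ∧ v ≤ 2 * n ∧ a u (v - n) = 1) ∨
  (n + 1 ≤ u ∧ u ≤ 3 * n ∧ v = u + n) ∨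
  (3 * n + 1 ≤ u ∧ u ≤ 4 * n ∧ 4 * n + 1 ≤ v ∧ v ≤ 5 * n ∧ b (v - 4 * n) (u - 3 * n) = 1) ∨
  (4 * n + 1 ≤ u ∧ 1 ≤ v ∧ v ≤ n ∧ u = v + 4 * n)

/-- Index of the block of a vertex. -/
def col5 (n v : ℕ) : ℕ :=
  if v ≤ n then 0 else if v ≤ 2 * n then 1 else if v ≤ 3 * n then 2 else if v ≤ 4 * n then 3 else 4

theorem up5_of_edge {n : ℕ} {a b : ℕ → ℕ → ℕ} {u v : ℕ} (h : cycle5X n a b u v = 1) :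
    Up5 n a b u v ∨ Up5 n a b v u := by
  unfold cycle5X at h
  unfold Up5
  split_ifs at h with h1 h2 h3 h3' h4 h4' h5 h6 h7 h7' h8 h8'
  · exact Or.inl (Or.inl ⟨h1.1, h1.2.1, h1.2.2.1, h1.2.2.2, h⟩)
  · exact Or.inr (Or.inl ⟨h2.1, h2.2.1, h2.2.2.1, h2.2.2.2, h⟩)
  · exact Or.inl (Or.inr (Or.inl ⟨h3.1, h3.2.1, h3'⟩))
  · exact Or.inr (Or.inr (Or.inl ⟨h4.1, h4.2.1, h4'⟩))
  · exact Or.inl (Or.inr (Or.inr (Or.inl ⟨h5.1, h5.2.1, h5.2.2.1, h5.2.2.2, h⟩)))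
  · exact Or.inr (Or.inr (Or.inr (Or.inl ⟨h6.1, h6.2.1, h6.2.2.1, h6.2.2.2, h⟩)))
  · exact Or.inl (Or.inr (Or.inr (Or.inr ⟨h7.1, h7.2.2.1, h7.2.2.2, h7'⟩)))
  · exact Or.inr (Or.inr (Or.inr (Or.inr ⟨h8.1, h8.2.2.1, h8.2.2.2, h8'⟩)))

theorem col5_lt (n v : ℕ) : col5 n v < 5 := by
  unfold col5; split_ifs <;> omega

theorem col5_up {n : ℕ} {a b : ℕ → ℕ → ℕ} {u v : ℕ} (h : Up5 n a b u v) :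
    col5 n v = (col5 n u + 1) % 5 := by
  unfold col5
  rcases h with h | h | h | h <;> split_ifs <;> omega

theorem up5_base {n : ℕ} {a b : ℕ → ℕ → ℕ} {u v w x y : ℕ} (hu : col5 n u = 0)
    (h1 : Up5 n a b u v) (h2 : Up5 n a b v w) (h3 : Up5 n a b w x) (h4 : Up5 n a b x y)
    (h5 : Up5 n a b y u) :
    ∃ i j : ℕ, 1 ≤ i ∧ i ≤ n ∧ 1 ≤ j ∧ j ≤ n ∧ a i j = 1 ∧ b i j = 1 := by
  have hu' : u ≤ n := by
    unfold col5 at hu; split_ifs at hu; assumption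
  obtain ⟨p1, p2, p3, p4, p5⟩ : 1 ≤ u ∧ u ≤ n ∧ n + 1 ≤ v ∧ v ≤ 2 * n ∧ a u (v - n) = 1 := by
    rcases h1 with h | h | h | h
    · exact h
    all_goals omega
  have q2 : w = v + n := by rcases h2 with h | h | h | h <;> omega
  have q3 : x = w + n := by rcases h3 with h | h | h | h <;> omega
  obtain ⟨r1, r2, r3, r4, r5⟩ : 3 * n + 1 ≤ x ∧ x ≤ 4 * n ∧ 4 * n + 1 ≤ y ∧ y ≤ 5 * n ∧
      b (y - 4 * n) (x - 3 * n) = 1 := by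
    rcases h4 with h | h | h | h
    · omega
    · omega
    · exact h
    · omega
  have q5 : y = u + 4 * n := by rcases h5 with h | h | h | h <;> omega
  refine ⟨u, v - n, p1, p2, by omega, by omega, p5, ?_⟩
  have e1 : y - 4 * n = u := by omega
  have e2 : x - 3 * n = v - n := by omega
  rwa [e1, e2] at r5

theorem up5_cycle {n : ℕ} {a b : ℕ → ℕ → ℕ} {u v w x y : ℕ}
    (h1 : Up5 n a b u v) (h2 : Up5 n a b v w) (h3 : Up5 n a b w x) (h4 : Up5 n a b x y)
    (h5 : Up5 n a b y u) :
    ∃ i j : ℕ, 1 ≤ i ∧ i ≤ n ∧ 1 ≤ j ∧ j ≤ n ∧ a i j = 1 ∧ b i j = 1 := by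
  have c1 := col5_up h1
  have c2 := col5_up h2
  have c3 := col5_up h3
  have c4 := col5_up h4
  have l := col5_lt n u
  have : col5 n u = 0 ∨ col5 n v = 0 ∨ col5 n w = 0 ∨ col5 n x = 0 ∨ col5 n y = 0 := by omega
  rcases this with h | h | h | h | h
  · exact up5_base h h1 h2 h3 h4 h5
  · exact up5_base h h2 h3 h4 h5 h1
  · exact up5_base h h3 h4 h5 h1 h2
  · exact up5_base h h4 h5 h1 h2 h3
  · exact up5_base h h5 h1 h2 h3 h4

/-- **The set-disjointness encoding into 5-cycle detection** (key step of
Theorem `2trans-fivecycle`). With `N = 5n` divisible by 5 and `a, b ∈ {0,1}^{[n]×[n]}`,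
the undirected graph `cycle5X n a b` contains a cycle of length 5 (five distinct vertices in
`[N]` joined cyclically by edges) iff there are `i, j ∈ [n]` with `a_{ij} = b_{ij} = 1`
(in which case `(i, n+j, 2n+j, 3n+j, 4n+i)` is such a cycle). -/
theorem cycle5_disjointness_encoding
    (n : ℕ) (hn : 1 ≤ n) (a b : ℕ → ℕ → ℕ)
    (ha : ∀ i j, a i j ≤ 1) (hb : ∀ i j, b i j ≤ 1) :
    ((∃ v₁ v₂ v₃ v₄ v₅ : ℕ,
        (1 ≤ v₁ ∧ v₁ ≤ 5 * n) ∧ (1 ≤ v₂ ∧ v₂ ≤ 5 * n) ∧ (1 ≤ v₃ ∧ v₃ ≤ 5 * n) ∧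
        (1 ≤ v₄ ∧ v₄ ≤ 5 * n) ∧ (1 ≤ v₅ ∧ v₅ ≤ 5 * n) ∧
        [v₁, v₂, v₃, v₄, v₅].Pairwise (· ≠ ·) ∧
        cycle5X n a b v₁ v₂ = 1 ∧ cycle5X n a b v₂ v₃ = 1 ∧ cycle5X n a b v₃ v₄ = 1 ∧
        cycle5X n a b v₄ v₅ = 1 ∧ cycle5X n a b v₅ v₁ = 1) ↔
      ∃ i j : ℕ, 1 ≤ i ∧ i ≤ n ∧ 1 ≤ j ∧ j ≤ n ∧ a i j = 1 ∧ b i j = 1) := by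
  constructor
  · rintro ⟨v₁, v₂, v₃, v₄, v₅, -, -, -, -, -, -, e1, e2, e3, e4, e5⟩
    have l1 := col5_lt n v₁
    have l2 := col5_lt n v₂
    have l3 := col5_lt n v₃
    have l4 := col5_lt n v₄
    have l5 := col5_lt n v₅
    rcases up5_of_edge e1 with h1 | h1 <;> rcases up5_of_edge e2 with h2 | h2 <;>
    rcases up5_of_edge e3 with h3 | h3 <;> rcases up5_of_edge e4 with h4 | h4 <;>
    rcases up5_of_edge e5 with h5 | h5 <;>
    first
    | exact up5_cycle h1 h2 h3 h4 h5
    | exact up5_cycle h5 h4 h3 h2 h1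
    | (exfalso
       have c1 := col5_up h1
       have c2 := col5_up h2
       have c3 := col5_up h3
       have c4 := col5_up h4
       have c5 := col5_up h5
       clear h1 h2 h3 h4 h5 e1 e2 e3 e4 e5
       omega)
  · rintro ⟨i, j, hi, hi', hj, hj', haij, hbij⟩
    refine ⟨i, n + j, 2 * n + j, 3 * n + j, 4 * n + i, by omega, by omega, by omega, by omega,
      by omega, ?_, ?_, ?_, ?_, ?_, ?_⟩
    · simp only [List.pairwise_cons, List.mem_cons, List.not_mem_nil, or_false, forall_eq_or_imp,
        forall_eq, List.Pairwise.nil, and_true, false_imp_iff, implies_true]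
      omega
    · unfold cycle5X
      rw [if_pos (by omega), show n + j - n = j by omega]
      exact haij
    · unfold cycle5X
      rw [if_neg (by omega), if_neg (by omega), if_pos (by omega), if_pos (by omega)]
    · unfold cycle5X
      rw [if_neg (by omega), if_neg (by omega), if_pos (by omega), if_pos (by omega)]
    · unfold cycle5X
      rw [if_neg (by omega), if_neg (by omega), if_neg (by omega), if_neg (by omega),
        if_pos (by omega), show 4 * n + i - 4 * n = i by omega,
        show 3 * n + j - 3 * n = j by omega]
      exact hbij
    · unfold cycle5X
      rw [if_neg (by omega), if_neg (by omega), if_neg (by omega), if_neg (by omega),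
        if_neg (by omega), if_neg (by omega), if_pos (by omega), if_pos (by omega)]
end

section
/- Let N be divisible by 4, set n = N²/16, and let a, b ∈ {0,1}^{[N/4]×[N/4]}. Define the (not necessarily symmetric) matrix X ∈ {0,1}^{N×N} by: x_{i,j} = a_{i, j−N/2} for i ∈ (0, N/4] and j ∈ (N/2, 3N/4]; x_{i,j} = b_{j−3N/4, i−N/2} for i ∈ (N/2, 3N/4] and j ∈ (3N/4, N]; x_{i,j} = 𝟙[i = j + 3N/4] for i ∈ (3N/4, N] and j ∈ (0, N/4]; and x_{i,j} = 0 for all other pairs. Then the directed graph with adjacency matrix X contains a directed 3-cycle (i.e., vertices v₁, v₂, v₃ with x_{v₁,v₂} = x_{v₂,v₃} = x_{v₃,v₁} = 1) if and only if there exist i, j ∈ [N/4] with a_{i,j} = b_{i,j} = 1 (in which case (i, N/2+j, 3N/4+i) is such a cycle). -/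
open scoped BigOperators

/-- The adjacency matrix (1-indexed, on vertices `1, …, 4n`) of the directed graph encoding
a set-disjointness instance `a, b ∈ {0,1}^{[n]×[n]}` for the directed-3-cycle lower bound:
edges from block 1 to block 3 according to `a`, from block 3 to block 4 according to `b`,
and from block 4 back to block 1 along a perfect matching; no other edges. -/
def dirCycle3X (n : ℕ) (a b : ℕ → ℕ → ℕ) : ℕ → ℕ → ℕ := fun i j =>
  if 1 ≤ i ∧ i ≤ n ∧ 2 * n + 1 ≤ j ∧ j ≤ 3 * n then a i (j - 2 * n)
  else if 2 * n + 1 ≤ i ∧ i ≤ 3 * n ∧ 3 * n + 1 ≤ j ∧ j ≤ 4 * n then b (j - 3 * n) (i - 2 * n)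
  else if 3 * n + 1 ≤ i ∧ i ≤ 4 * n ∧ 1 ≤ j ∧ j ≤ n ∧ i = j + 3 * n then 1
  else 0

/-- Classification of the edges of the graph. -/
theorem dirCycle3X_edge (n : ℕ) (a b : ℕ → ℕ → ℕ) (i j : ℕ) (h : dirCycle3X n a b i j = 1) :
    (1 ≤ i ∧ i ≤ n ∧ 2 * n + 1 ≤ j ∧ j ≤ 3 * n ∧ a i (j - 2 * n) = 1) ∨
    (2 * n + 1 ≤ i ∧ i ≤ 3 * n ∧ 3 * n + 1 ≤ j ∧ j ≤ 4 * n ∧ b (j - 3 * n) (i - 2 * n) = 1) ∨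
    (3 * n + 1 ≤ i ∧ i ≤ 4 * n ∧ 1 ≤ j ∧ j ≤ n ∧ i = j + 3 * n) := by
  unfold dirCycle3X at h
  split_ifs at h with h1 h2 h3
  · exact Or.inl ⟨h1.1, h1.2.1, h1.2.2.1, h1.2.2.2, h⟩
  · exact Or.inr (Or.inl ⟨h2.1, h2.2.1, h2.2.2.1, h2.2.2.2, h⟩)
  · exact Or.inr (Or.inr h3)

/-- A cycle that starts in the first block yields a common element. -/
theorem dirCycle3X_common (n : ℕ) (a b : ℕ → ℕ → ℕ) (u v w : ℕ)
    (hu : 1 ≤ u ∧ u ≤ n) (hv : 2 * n + 1 ≤ v ∧ v ≤ 3 * n) (hw : w = u + 3 * n)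
    (h1 : a u (v - 2 * n) = 1) (h2 : b (w - 3 * n) (v - 2 * n) = 1) :
    ∃ i j : ℕ, 1 ≤ i ∧ i ≤ n ∧ 1 ≤ j ∧ j ≤ n ∧ a i j = 1 ∧ b i j = 1 := by
  have e : w - 3 * n = u := by omega
  rw [e] at h2
  exact ⟨u, v - 2 * n, hu.1, hu.2, by omega, by omega, h1, h2⟩

/-- **The set-disjointness encoding into directed-3-cycle detection** (key step of
Theorem `2trans-tricycle`). With `N = 4n` divisible by 4 and `a, b ∈ {0,1}^{[n]×[n]}`,
the directed graph `dirCycle3X n a b` contains a directed 3-cycle (vertices `v₁, v₂, v₃`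
with edges `v₁ → v₂ → v₃ → v₁`) iff there are `i, j ∈ [n]` with `a_{ij} = b_{ij} = 1`
(in which case `(i, 2n+j, 3n+i)` is such a cycle). -/
theorem directedCycle3_disjointness_encoding
    (n : ℕ) (hn : 1 ≤ n) (a b : ℕ → ℕ → ℕ)
    (ha : ∀ i j, a i j ≤ 1) (hb : ∀ i j, b i j ≤ 1) :
    ((∃ v₁ v₂ v₃ : ℕ,
        (1 ≤ v₁ ∧ v₁ ≤ 4 * n) ∧ (1 ≤ v₂ ∧ v₂ ≤ 4 * n) ∧ (1 ≤ v₃ ∧ v₃ ≤ 4 * n) ∧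
        dirCycle3X n a b v₁ v₂ = 1 ∧ dirCycle3X n a b v₂ v₃ = 1 ∧
        dirCycle3X n a b v₃ v₁ = 1) ↔
      ∃ i j : ℕ, 1 ≤ i ∧ i ≤ n ∧ 1 ≤ j ∧ j ≤ n ∧ a i j = 1 ∧ b i j = 1) := by
  constructor
  · rintro ⟨u, v, w, -, -, -, h1, h2, h3⟩
    rcases dirCycle3X_edge n a b _ _ h1 with c1 | c1 | c1 <;>
    rcases dirCycle3X_edge n a b _ _ h2 with c2 | c2 | c2 <;>
    rcases dirCycle3X_edge n a b _ _ h3 with c3 | c3 | c3 <;>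
    first
    | (exfalso; omega)
    | exact dirCycle3X_common n a b u v w (by omega) (by omega) (by omega)
        c1.2.2.2.2 c2.2.2.2.2
    | exact dirCycle3X_common n a b v w u (by omega) (by omega) (by omega)
        c2.2.2.2.2 c3.2.2.2.2
    | exact dirCycle3X_common n a b w u v (by omega) (by omega) (by omega)
        c3.2.2.2.2 c1.2.2.2.2
  · rintro ⟨i, j, hi, hi', hj, hj', h1, h2⟩
    refine ⟨i, 2 * n + j, 3 * n + i, by omega, by omega, by omega, ?_, ?_, ?_⟩
    · unfold dirCycle3X
      rw [if_pos (by omega), Nat.add_sub_cancel_left, h1]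
    · unfold dirCycle3X
      rw [if_neg (by omega), if_pos (by omega), Nat.add_sub_cancel_left,
        Nat.add_sub_cancel_left, h2]
    · unfold dirCycle3X
      rw [if_neg (by omega), if_neg (by omega), if_pos (by omega)]
end
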